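/- The affine feedback product is a right action of the group (G, ⊙) on ℝ⟨⟨X⟩⟩: for every c ∈ ℝ⟨⟨X⟩⟩ and all x, y ∈ G, (c @ x) @ y = c @ (x ⊙ y), and c @ e = c, where e = (𝟙, 0). -/

import Mathlib

open scoped Classical

/-!  Common setup: noncommutative formal power series ℝ⟨⟨X⟩⟩ over the
alphabet X = {x₀, x₁}.  Words are encoded as lists over `Fin 2`
(the letter `0` is x₀ and `1` is x₁); a series is a function from words
to ℝ, recording its coefficients. -/

/-- Words over the alphabet X = {x₀, x₁}. -/
abbrev Word : Type := List (Fin 2)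

/-- Noncommutative formal power series ℝ⟨⟨X⟩⟩. -/
abbrev Ser : Type := Word → ℝ

/-- The series 𝟙 (the empty word). -/
def one1 : Ser := fun w => if w = [] then 1 else 0

/-- A single word η regarded as a series. -/
def mono (η : Word) : Ser := fun w => if w = η then 1 else 0

/-- Left concatenation of a series by the letter `x_i`. -/
def lc (i : Fin 2) (c : Ser) : Ser := fun w =>
  match w with
  | [] => 0
  | j :: u => if j = i then c u else 0

/-- Auxiliary recursion computing the coefficient of a word `w` in `c ⧢ d`:
`(c ⧢ d)(𝟙) = c(𝟙) d(𝟙)` and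
`(c ⧢ d)(x_i w) = ((x_i⁻¹ c) ⧢ d)(w) + (c ⧢ (x_i⁻¹ d))(w)`,
where `x_i⁻¹` is the left shift.  This dual recursion is exactly the
bilinear extension of the inductive shuffle of words
`(x_i ξ) ⧢ (x_j η) = x_i (ξ ⧢ x_j η) + x_j (x_i ξ ⧢ η)`, `𝟙 ⧢ η = η ⧢ 𝟙 = η`. -/
def shAux : Word → Ser → Ser → ℝ
  | [], c, d => c [] * d []
  | i :: w, c, d => shAux w (fun u => c (i :: u)) d + shAux w c (fun u => d (i :: u))

/-- The shuffle product `⧢` on ℝ⟨⟨X⟩⟩. -/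
def sh (c d : Ser) : Ser := fun w => shAux w c d

/-- Shuffle powers `c^{⧢ k}`. -/
def shPow (c : Ser) : ℕ → Ser
  | 0 => one1
  | k + 1 => sh c (shPow c k)

/-- The shuffle inverse `c^{⧢ -1} = Σ_{k ≥ 0} (𝟙 - c)^{⧢ k}`.
When `c(𝟙) = 1` the sum is locally finite (for each word only finitely many
terms are nonzero) and `∑'` returns it. -/
noncomputable def shInv (c : Ser) : Ser := fun w => ∑' k : ℕ, shPow (one1 - c) k w

/-- Composition product restricted to words: `𝟙 ∘ d = 𝟙`,
`(x₀ η) ∘ d = x₀ (η ∘ d)`, `(x₁ η) ∘ d = x₀ (d ⧢ (η ∘ d))`. -/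
def wordComp : Word → Ser → Ser
  | [], _ => one1
  | i :: η, d => if i = 0 then lc 0 (wordComp η d) else lc 0 (sh d (wordComp η d))

/-- The composition product `c ∘ d = Σ_η c(η) (η ∘ d)`.  For each fixed word
only finitely many terms are nonzero, and `∑'` returns the sum. -/
noncomputable def comp (c d : Ser) : Ser := fun w => ∑' η : Word, c η * wordComp η d w

/-- Membership in the set `G`: pairs `(d₁, d₂)` with `d₁(𝟙) = 1`. -/
def inG (d : Ser × Ser) : Prop := d.1 [] = 1

/-- Mixed composition product restricted to words: `𝟙 ◁ d = 𝟙`,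
`(x₀ η) ◁ d = x₀ (η ◁ d)`,
`(x₁ η) ◁ d = x₁ (d₁ ⧢ (η ◁ d)) + x₀ (d₂ ⧢ (η ◁ d))`. -/
def wordMComp : Word → Ser × Ser → Ser
  | [], _ => one1
  | i :: η, d =>
      if i = 0 then lc 0 (wordMComp η d)
      else lc 1 (sh d.1 (wordMComp η d)) + lc 0 (sh d.2 (wordMComp η d))

/-- The mixed composition product `c ◁ d = Σ_η c(η) (η ◁ d)`. -/
noncomputable def mcomp (c : Ser) (d : Ser × Ser) : Ser :=
  fun w => ∑' η : Word, c η * wordMComp η d w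

/-- Componentwise mixed composition `c ⊲ d = (c₁ ◁ d, c₂ ◁ d)`. -/
noncomputable def tri (c d : Ser × Ser) : Ser × Ser := (mcomp c.1 d, mcomp c.2 d)

/-- Componentwise composition `d ∘̄ c = (d₁ ∘ c, d₂ ∘ c)`. -/
noncomputable def bcomp (d : Ser × Ser) (c : Ser) : Ser × Ser := (comp d.1 c, comp d.2 c)

/-- The group product `⊙` on `G`:
`(c₁, c₂) ⊙ (d₁, d₂) = (c₁ ⧢ d₁, c₂ + d₂ ⧢ c₁)`. -/
def odot (c d : Ser × Ser) : Ser × Ser := (sh c.1 d.1, c.2 + sh d.2 c.1)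

/-- The identity element `e = (𝟙, 0)`. -/
def eG : Ser × Ser := (one1, 0)

/-- The `⊙`-inverse `c^{⊙ -1} = (c₁^{⧢ -1}, -(c₁^{⧢ -1} ⧢ c₂))`. -/
noncomputable def odotInv (c : Ser × Ser) : Ser × Ser :=
  (shInv c.1, -(sh (shInv c.1) c.2))

/-- The affine feedback group product `c ⋆ d = (c ⊲ d) ⊙ d` on `G`. -/
noncomputable def star (c d : Ser × Ser) : Ser × Ser := odot (tri c d) d

/-- The `⋆`-inverse of an element of `G` (defined via choice; for an element
of the group `(G, ⋆)` it is the unique two-sided `⋆`-inverse). -/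
noncomputable def starInv (x : Ser × Ser) : Ser × Ser :=
  if h : ∃ y : Ser × Ser, inG y ∧ star x y = eG ∧ star y x = eG then h.choose else x

/-- The affine feedback product `c @ d = c ◁ ((d^{⊙ -1}) ∘̄ c)^{⋆ -1}`. -/
noncomputable def atp (c : Ser) (d : Ser × Ser) : Ser :=
  mcomp c (starInv (bcomp (odotInv d) c))

/-- Membership in ℝ[[x₀]]: series vanishing on every word containing x₁. -/
def inRx0 (c : Ser) : Prop := ∀ w : Word, (1 : Fin 2) ∈ w → c w = 0

/-- The left shift `x_i⁻¹ c`. -/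
def lshift (i : Fin 2) (c : Ser) : Ser := fun w => c (i :: w)

@[simp] theorem lshift_add (i : Fin 2) (a b : Ser) :
    lshift i (a + b) = lshift i a + lshift i b := rfl

@[simp] theorem lshift_zero (i : Fin 2) : lshift i 0 = 0 := rfl

@[simp] theorem lshift_one1 (i : Fin 2) : lshift i one1 = 0 := by
  funext w; simp [lshift, one1]

@[simp] theorem lshift_lc_same (i : Fin 2) (c : Ser) : lshift i (lc i c) = c := by
  funext w; simp [lshift, lc]

theorem lshift_lc_ne {i j : Fin 2} (h : i ≠ j) (c : Ser) : lshift i (lc j c) = 0 := by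
  funext w; simp [lshift, lc, h]

theorem sh_nil (a b : Ser) : sh a b [] = a [] * b [] := rfl

theorem sh_cons (a b : Ser) (i : Fin 2) (w : Word) :
    sh a b (i :: w) = sh (lshift i a) b w + sh a (lshift i b) w := rfl

@[simp] theorem lshift_sh (i : Fin 2) (a b : Ser) :
    lshift i (sh a b) = sh (lshift i a) b + sh a (lshift i b) := rfl

theorem sh_comm (a b : Ser) : sh a b = sh b a := by
  funext w
  induction w generalizing a b with
  | nil => simp [sh_nil, mul_comm]
  | cons i w ih => rw [sh_cons, sh_cons, ih, ih a, add_comm]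

theorem sh_add (a b c : Ser) : sh a (b + c) = sh a b + sh a c := by
  funext w
  induction w generalizing a b c with
  | nil => simp [sh_nil, mul_add]
  | cons i w ih =>
    simp only [Pi.add_apply] at ih
    simp only [Pi.add_apply, sh_cons, lshift_add, ih]
    ring

theorem sh_smul (r : ℝ) (a b : Ser) : sh a (r • b) = r • sh a b := by
  funext w
  induction w generalizing a b with
  | nil => simp [sh_nil]; ring
  | cons i w ih =>
    have h : lshift i (r • b) = r • lshift i b := rfl
    simp only [Pi.smul_apply, smul_eq_mul] at ih
    simp only [Pi.smul_apply, smul_eq_mul, sh_cons, h, ih]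
    ring

theorem add_sh (a b c : Ser) : sh (a + b) c = sh a c + sh b c := by
  rw [sh_comm, sh_add, sh_comm c, sh_comm c]

theorem sh_assoc (a b c : Ser) : sh (sh a b) c = sh a (sh b c) := by
  funext w
  induction w generalizing a b c with
  | nil => simp [sh_nil, mul_assoc]
  | cons i w ih =>
    simp only [sh_cons, lshift_sh, add_sh, sh_add, Pi.add_apply, ih]
    ring

theorem sh_left_comm (a b c : Ser) : sh a (sh b c) = sh b (sh a c) := by
  rw [← sh_assoc, sh_comm a b, sh_assoc]

@[simp] theorem sh_zero (a : Ser) : sh a 0 = 0 := by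
  simpa using sh_smul 0 a 0

@[simp] theorem zero_sh (a : Ser) : sh 0 a = 0 := by
  rw [sh_comm, sh_zero]

theorem sh_neg (a b : Ser) : sh a (-b) = -sh a b := by
  simpa using sh_smul (-1) a b

theorem neg_sh (a b : Ser) : sh (-a) b = -sh a b := by
  rw [sh_comm, sh_neg, sh_comm]

@[simp] theorem sh_one1 (a : Ser) : sh a one1 = a := by
  funext w
  induction w generalizing a with
  | nil => simp [sh_nil, one1]
  | cons i w ih => rw [sh_cons, ih]; simp [lshift]

@[simp] theorem one1_sh (a : Ser) : sh one1 a = a := by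
  rw [sh_comm, sh_one1]

/-- Two series have the same coefficients on all words of length at most `n`. -/
def AgreeUpTo (n : ℕ) (a b : Ser) : Prop := ∀ w : Word, w.length ≤ n → a w = b w

theorem AgreeUpTo.refl (n : ℕ) (a : Ser) : AgreeUpTo n a a := fun _ _ => rfl

theorem AgreeUpTo.add {n : ℕ} {a a' b b' : Ser} (ha : AgreeUpTo n a a')
    (hb : AgreeUpTo n b b') : AgreeUpTo n (a + b) (a' + b') := fun w hw => by
  simp [ha w hw, hb w hw]

theorem AgreeUpTo.sh {n : ℕ} {a a' b b' : Ser} (ha : AgreeUpTo n a a')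
    (hb : AgreeUpTo n b b') : AgreeUpTo n (sh a b) (sh a' b') := by
  intro w
  induction w generalizing n a a' b b' with
  | nil => intro _; rw [sh_nil, sh_nil, ha [] (by simp), hb [] (by simp)]
  | cons i w ih =>
    intro hw
    obtain ⟨m, rfl⟩ : ∃ m, n = m + 1 := ⟨n - 1, by simp at hw; omega⟩
    have shift {c c' : Ser} (h : AgreeUpTo (m + 1) c c') :
        AgreeUpTo m (lshift i c) (lshift i c') :=
      fun u hu => h (i :: u) (by simpa using hu)
    have weaken {c c' : Ser} (h : AgreeUpTo (m + 1) c c') : AgreeUpTo m c c' :=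
      fun u hu => h u (by omega)
    have hw' : w.length ≤ m := by simpa using hw
    rw [sh_cons, sh_cons, ih (shift ha) (weaken hb) hw', ih (weaken ha) (shift hb) hw']

/-- Coinduction principle for families of series. -/
theorem eq_of_agree_lshift {ι : Type*} {f g : ι → Ser} (h0 : ∀ k, f k [] = g k [])
    (hs : ∀ n, (∀ k, AgreeUpTo n (f k) (g k)) →
      ∀ k i, AgreeUpTo n (lshift i (f k)) (lshift i (g k))) (k : ι) : f k = g k := by
  have key : ∀ n k, AgreeUpTo n (f k) (g k) := by
    intro n
    induction n with
    | zero =>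
      intro k w hw
      obtain rfl : w = [] := by simpa using hw
      exact h0 k
    | succ n ih =>
      intro k w hw
      cases w with
      | nil => exact h0 k
      | cons i w => exact hs n ih k i w (by simpa using hw)
  exact funext fun w => key w.length k w le_rfl

/-- The left shift as a continuous linear map. -/
def lshiftCLM (i : Fin 2) : Ser →L[ℝ] Ser where
  toFun := lshift i
  map_add' _ _ := rfl
  map_smul' _ _ := rfl
  cont := continuous_pi fun w => continuous_apply (i :: w)

theorem continuous_sh_apply (a : Ser) (w : Word) : Continuous fun b : Ser => sh a b w := by
  induction w generalizing a with
  | nil => exact continuous_const.mul (continuous_apply _)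
  | cons i w ih => exact (ih (lshift i a)).add ((ih a).comp (lshiftCLM i).continuous)

/-- Shuffling with a fixed series as a continuous linear map. -/
def shCLM (a : Ser) : Ser →L[ℝ] Ser where
  toFun := sh a
  map_add' := sh_add a
  map_smul' r b := sh_smul r a b
  cont := continuous_pi (continuous_sh_apply a)

theorem sh_apply_eq_zero (a b : Ser) {n : ℕ} (hb : ∀ w : Word, w.length ≤ n → b w = 0)
    {w : Word} (hw : w.length ≤ n) : sh a b w = 0 := by
  have h := (AgreeUpTo.refl n a).sh (b := b) (b' := 0) hb w hw
  simpa using h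

theorem wordMComp_eq_zero (d : Ser × Ser) (η w : Word) (h : w.length < η.length) :
    wordMComp η d w = 0 := by
  induction η generalizing w with
  | nil => simp at h
  | cons i η ih =>
    cases w with
    | nil => simp only [wordMComp]; split_ifs <;> simp [lc]
    | cons j w =>
      have hw : w.length < η.length := by simpa using h
      have hsh (a : Ser) : sh a (wordMComp η d) w = 0 :=
        sh_apply_eq_zero a _ (fun u hu => ih u (by omega)) le_rfl
      simp only [wordMComp]
      split_ifs <;> simp [lc, ih w hw, hsh]

theorem hasSum_mcomp (c : Ser) (d : Ser × Ser) :
    HasSum (fun η => c η • wordMComp η d) (mcomp c d) := by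
  refine Pi.hasSum.2 fun w => Summable.hasSum (f := fun η => c η * wordMComp η d w) ?_
  refine summable_of_hasFiniteSupport
    ((List.finite_length_le (Fin 2) w.length).subset fun η hη => ?_)
  by_contra hlt
  exact hη (by simp [wordMComp_eq_zero d η w (by simpa using hlt)])

theorem hasSum_word {f : Word → Ser} {a b : Ser} (hnil : f [] = 0)
    (ha : HasSum (fun η => f (0 :: η)) a) (hb : HasSum (fun η => f (1 :: η)) b) :
    HasSum f (a + b) := by
  have part (i : Fin 2) {s : Ser} (hs : HasSum (fun η => f (i :: η)) s) :
      HasSum (fun w : Word => if w.head? = some i then f w else 0) s := by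
    refine ((List.cons_injective (a := i)).hasSum_iff ?_).1 (by simpa [Function.comp_def] using hs)
    rintro (_ | ⟨j, w⟩) hw
    · simp
    · have : j ≠ i := fun h => hw ⟨w, by rw [h]⟩
      simp [this]
  convert (part 0 ha).add (part 1 hb) using 2 with w
  rcases w with _ | ⟨i, w⟩
  · simp [hnil]
  · fin_cases i <;> simp

theorem lshift_zero_mcomp (c : Ser) (d : Ser × Ser) :
    lshift 0 (mcomp c d) = mcomp (lshift 0 c) d + sh d.2 (mcomp (lshift 1 c) d) := by
  refine ((lshiftCLM 0).hasSum (hasSum_mcomp c d)).unique (hasSum_word ?_ ?_ ?_)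
  · change c [] • lshift 0 one1 = 0
    simp
  · convert hasSum_mcomp (lshift 0 c) d using 2 with η
    change c (0 :: η) • lshift 0 (wordMComp (0 :: η) d) = _
    simp [wordMComp, lshift]
  · convert (shCLM d.2).hasSum (hasSum_mcomp (lshift 1 c) d) using 2 with η
    · change c (1 :: η) • lshift 0 (wordMComp (1 :: η) d) = sh d.2 (c (1 :: η) • wordMComp η d)
      simp only [wordMComp, sh_smul]
      simp [lshift_lc_ne]
    · rfl

theorem lshift_one_mcomp (c : Ser) (d : Ser × Ser) :
    lshift 1 (mcomp c d) = sh d.1 (mcomp (lshift 1 c) d) := by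
  rw [← zero_add (sh d.1 _)]
  refine ((lshiftCLM 1).hasSum (hasSum_mcomp c d)).unique (hasSum_word ?_ ?_ ?_)
  · change c [] • lshift 1 one1 = 0
    simp
  · convert hasSum_zero using 2 with η
    change c (0 :: η) • lshift 1 (wordMComp (0 :: η) d) = 0
    simp [wordMComp, lshift_lc_ne]
  · convert (shCLM d.1).hasSum (hasSum_mcomp (lshift 1 c) d) using 2 with η
    · change c (1 :: η) • lshift 1 (wordMComp (1 :: η) d) = sh d.1 (c (1 :: η) • wordMComp η d)
      simp only [wordMComp, sh_smul]
      simp [lshift_lc_ne]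
    · rfl

@[simp] theorem mcomp_nil (c : Ser) (d : Ser × Ser) : mcomp c d [] = c [] := by
  have h := (Pi.hasSum.1 (hasSum_mcomp c d) []).unique (hasSum_single [] fun η hη => by
    simp [wordMComp_eq_zero d η [] (List.length_pos_iff.2 hη)])
  simpa [wordMComp, one1] using h

theorem mcomp_add (a b : Ser) (d : Ser × Ser) :
    mcomp (a + b) d = mcomp a d + mcomp b d := by
  refine (hasSum_mcomp (a + b) d).unique ?_
  simpa [add_smul] using (hasSum_mcomp a d).add (hasSum_mcomp b d)

@[simp] theorem zero_mcomp (d : Ser × Ser) : mcomp 0 d = 0 := by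
  funext w; simp [mcomp]

@[simp] theorem one1_mcomp (d : Ser × Ser) : mcomp one1 d = one1 := by
  refine eq_of_agree_lshift (ι := Unit) (f := fun _ => mcomp one1 d) (g := fun _ => one1)
    (fun _ => mcomp_nil _ _) (fun n _ _ i => ?_) ()
  fin_cases i <;>
    simp [lshift_zero_mcomp, lshift_one_mcomp, AgreeUpTo.refl]

theorem mcomp_sh (a b : Ser) (d : Ser × Ser) :
    mcomp (sh a b) d = sh (mcomp a d) (mcomp b d) := by
  refine eq_of_agree_lshift (f := fun p : Ser × Ser => mcomp (sh p.1 p.2) d)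
    (g := fun p => sh (mcomp p.1 d) (mcomp p.2 d)) (by simp [sh_nil])
    (fun n ih p i => ?_) (a, b)
  obtain ⟨a, b⟩ := p
  have key (i : Fin 2) := (ih (lshift i a, b)).add (ih (a, lshift i b))
  fin_cases i
  · convert (key 0).add ((AgreeUpTo.refl n d.2).sh (key 1)) using 1
    · simp [lshift_zero_mcomp, mcomp_add]
    · simp only [Fin.zero_eta, lshift_sh, lshift_zero_mcomp, add_sh, sh_add, sh_assoc,
        sh_left_comm (mcomp a d) d.2]
      ac_rfl
  · convert (AgreeUpTo.refl n d.1).sh (key 1) using 1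
    · simp [lshift_one_mcomp, mcomp_add]
    · simp only [Fin.mk_one, lshift_sh, lshift_one_mcomp, sh_add, sh_assoc,
        sh_left_comm (mcomp a d) d.1]

theorem mcomp_mcomp (c : Ser) (d d' : Ser × Ser) :
    mcomp (mcomp c d) d' = mcomp c (_root_.star d d') := by
  refine eq_of_agree_lshift (f := fun c : Ser => mcomp (mcomp c d) d')
    (g := fun c => mcomp c (_root_.star d d')) (by simp) (fun n ih c i => ?_) c
  fin_cases i
  · convert (ih (lshift 0 c)).add
      ((AgreeUpTo.refl n (_root_.star d d').2).sh (ih (lshift 1 c))) using 1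
    · simp only [Fin.zero_eta, lshift_zero_mcomp, lshift_one_mcomp, mcomp_add, mcomp_sh,
        _root_.star, tri, odot, add_sh, sh_assoc]
      ac_rfl
    · simp [lshift_zero_mcomp]
  · convert (AgreeUpTo.refl n (_root_.star d d').1).sh (ih (lshift 1 c)) using 1
    · simp only [Fin.mk_one, lshift_one_mcomp, mcomp_sh, _root_.star, tri, odot, sh_assoc]
      rw [sh_left_comm]
    · simp [lshift_one_mcomp]

@[simp] theorem mcomp_eG (c : Ser) : mcomp c eG = c := by
  refine eq_of_agree_lshift (f := fun c : Ser => mcomp c eG) (g := fun c => c)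
    (by simp) (fun n ih c i => ?_) c
  fin_cases i <;>
    simpa [lshift_zero_mcomp, lshift_one_mcomp, eG] using ih _

theorem wordComp_eq_wordMComp (η : Word) (d : Ser) : wordComp η d = wordMComp η (0, d) := by
  have hlc : lc 1 0 = 0 := by
    funext w; cases w <;> simp [lc]
  induction η with
  | nil => rfl
  | cons i η ih => simp [wordComp, wordMComp, ih, hlc]

theorem comp_eq_mcomp (c d : Ser) : comp c d = mcomp c (0, d) := by
  funext w
  simp [comp, mcomp, wordComp_eq_wordMComp]

theorem mcomp_comp (a b : Ser) (d : Ser × Ser) :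
    mcomp (comp a b) d = comp a (mcomp b d) := by
  simp [comp_eq_mcomp, mcomp_mcomp, _root_.star, tri, odot]

theorem shPow_apply_eq_zero {a : Ser} (ha : a [] = 0) (k : ℕ) (w : Word)
    (hw : w.length < k) : shPow a k w = 0 := by
  have key (w : Word) (b c : Ser) (m : ℕ) (hb : b [] = 0)
      (hc : ∀ u : Word, u.length < m → c u = 0) (hw : w.length < m + 1) : sh b c w = 0 := by
    induction w generalizing m c with
    | nil => simp [sh_nil, hb]
    | cons i w ih =>
      have hw' : w.length < m := by simpa using hw
      obtain ⟨m, rfl⟩ : ∃ l, m = l + 1 := ⟨m - 1, by omega⟩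
      rw [sh_cons, sh_apply_eq_zero (n := m) _ c (fun u hu => hc u (by omega)) (by omega),
        ih (lshift i c) m (fun u hu => hc (i :: u) (by simpa using hu)) hw', add_zero]
  induction k generalizing w with
  | zero => simp at hw
  | succ k ih => exact key w a _ k ha ih hw

theorem hasSum_shInv {c : Ser} (hc : c [] = 1) :
    HasSum (shPow (one1 - c)) (shInv c) := by
  refine Pi.hasSum.2 fun w => Summable.hasSum (f := fun k => shPow (one1 - c) k w) ?_
  refine summable_of_hasFiniteSupport ((Set.finite_Iic w.length).subset fun k hk => ?_)
  by_contra hlt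
  exact hk (shPow_apply_eq_zero (by simp [one1, hc]) k w (by simpa using hlt))

theorem sh_shInv {c : Ser} (hc : c [] = 1) : sh c (shInv c) = one1 := by
  have h := hasSum_shInv hc
  have h1 : HasSum (fun k => shPow (one1 - c) (k + 1)) (sh (one1 - c) (shInv c)) :=
    (shCLM (one1 - c)).hasSum h
  have h2 := h.unique ((hasSum_nat_add_iff 1).1 h1)
  rw [sub_eq_add_neg, add_sh, neg_sh, one1_sh] at h2
  simp only [Finset.range_one, Finset.sum_singleton, shPow] at h2
  have h3 : shInv c + sh c (shInv c) = shInv c + one1 := by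
    nth_rewrite 1 [h2]; abel
  exact add_left_cancel h3

theorem shInv_nil {c : Ser} (hc : c [] = 1) : shInv c [] = 1 := by
  have h := congrFun (sh_shInv hc) []
  simpa [sh_nil, hc, one1] using h

theorem shInv_eq_of_sh_eq_one1 {a b : Ser} (ha : a [] = 1) (h : sh a b = one1) :
    shInv a = b := by
  rw [← sh_one1 (shInv a), ← h, ← sh_assoc, sh_comm _ a, sh_shInv ha, one1_sh]

theorem shInv_sh {a b : Ser} (ha : a [] = 1) (hb : b [] = 1) :
    shInv (sh a b) = sh (shInv a) (shInv b) := by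
  refine shInv_eq_of_sh_eq_one1 (by simp [sh_nil, ha, hb]) ?_
  rw [sh_assoc, sh_left_comm b, ← sh_assoc, sh_shInv ha, sh_shInv hb, one1_sh]

theorem inG.odotInv {x : Ser × Ser} (hx : inG x) : inG (odotInv x) :=
  shInv_nil hx

theorem inG.star {x y : Ser × Ser} (hx : inG x) (hy : inG y) : inG (_root_.star x y) := by
  simp_all [inG, _root_.star, _root_.odot, tri, sh_nil]

theorem inG_eG : inG eG := by simp [inG, eG, one1]

theorem odotInv_odot {x y : Ser × Ser} (hx : inG x) (hy : inG y) :
    odotInv (odot x y) = odot (odotInv y) (odotInv x) := by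
  simp only [odotInv, odot, shInv_sh hx hy, Prod.mk.injEq]
  refine ⟨sh_comm _ _, ?_⟩
  have h : sh (shInv x.1) (sh (shInv y.1) (sh y.2 x.1)) = sh (shInv y.1) y.2 := by
    rw [sh_comm y.2, sh_left_comm _ x.1, ← sh_assoc, sh_comm _ x.1, sh_shInv hx, one1_sh]
  rw [sh_add, sh_assoc, sh_assoc, h, neg_sh, neg_add, add_comm, sh_comm _ (shInv y.1),
    sh_left_comm]

/-- Coefficients of the preimage of `t` under `c ↦ c ◁ x`. -/
noncomputable def mcompPreimage (x : Ser × Ser) : Word → Ser → ℝ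
  | [], t => t []
  | i :: w, t =>
      if i = 0 then
        mcompPreimage x w (lshift 0 t - sh x.2 (sh (shInv x.1) (lshift 1 t)))
      else mcompPreimage x w (sh (shInv x.1) (lshift 1 t))

theorem mcomp_mcompPreimage {x : Ser × Ser} (hx : inG x) (t : Ser) :
    mcomp (fun w => mcompPreimage x w t) x = t := by
  refine eq_of_agree_lshift (f := fun t : Ser => mcomp (fun w => mcompPreimage x w t) x)
    (g := fun t => t) (by simp [mcompPreimage]) (fun n ih t i => ?_) t
  have h0 : lshift 0 (fun w => mcompPreimage x w t) = fun w =>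
      mcompPreimage x w (lshift 0 t - sh x.2 (sh (shInv x.1) (lshift 1 t))) := by
    funext w; simp [lshift, mcompPreimage]
  have h1 : lshift 1 (fun w => mcompPreimage x w t) = fun w =>
      mcompPreimage x w (sh (shInv x.1) (lshift 1 t)) := by
    funext w; simp [lshift, mcompPreimage]
  fin_cases i
  · convert (ih (lshift 0 t - sh x.2 (sh (shInv x.1) (lshift 1 t)))).add
      ((AgreeUpTo.refl n x.2).sh (ih (sh (shInv x.1) (lshift 1 t)))) using 1
    · simp [lshift_zero_mcomp, h0, h1]
    · simp
  · convert (AgreeUpTo.refl n x.1).sh (ih (sh (shInv x.1) (lshift 1 t))) using 1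
    · simp [lshift_one_mcomp, h1]
    · simp [← sh_assoc, sh_shInv (show x.1 [] = 1 from hx)]

theorem exists_star_eq_eG {x : Ser × Ser} (hx : inG x) :
    ∃ y, inG y ∧ _root_.star y x = eG := by
  refine ⟨(fun w => mcompPreimage x w (shInv x.1),
    fun w => mcompPreimage x w (-sh x.2 (shInv x.1))), shInv_nil hx, ?_⟩
  simp only [_root_.star, tri, odot, mcomp_mcompPreimage hx, eG, Prod.mk.injEq]
  exact ⟨by rw [sh_comm, sh_shInv hx], neg_add_cancel _⟩

theorem star_assoc (x y z : Ser × Ser) :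
    _root_.star (_root_.star x y) z = _root_.star x (_root_.star y z) := by
  refine Prod.ext ?_ ?_
  · simp only [_root_.star, tri, odot, mcomp_sh, sh_assoc]
    simp only [mcomp_mcomp, _root_.star, tri, odot]
  · have h := mcomp_mcomp
    simp only [_root_.star, tri, odot] at h
    simp only [_root_.star, tri, odot, mcomp_add, mcomp_sh, add_sh, h, sh_assoc, add_assoc]
    rw [sh_comm (mcomp y.1 z) (mcomp x.1 _)]

theorem eG_star (x : Ser × Ser) : _root_.star eG x = x := by
  simp [_root_.star, tri, odot, eG]

theorem star_eG (x : Ser × Ser) : _root_.star x eG = x := by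
  have h := mcomp_eG
  simp only [eG] at h
  simp [_root_.star, tri, odot, eG, h]

theorem star_eq_eG_comm {x y : Ser × Ser} (hy : inG y) (h : _root_.star y x = eG) :
    _root_.star x y = eG := by
  obtain ⟨z, -, hz⟩ := exists_star_eq_eG hy
  have hzx : z = x := by
    rw [← star_eG z, ← h, ← star_assoc, hz, eG_star]
  rw [← hzx, hz]

theorem starInv_spec {x : Ser × Ser} (hx : inG x) :
    inG (starInv x) ∧ _root_.star x (starInv x) = eG ∧ _root_.star (starInv x) x = eG := by
  obtain ⟨y, hy, hyx⟩ := exists_star_eq_eG hx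
  have h : ∃ y, inG y ∧ _root_.star x y = eG ∧ _root_.star y x = eG :=
    ⟨y, hy, star_eq_eG_comm hy hyx, hyx⟩
  rw [starInv, dif_pos h]
  exact h.choose_spec

theorem starInv_eq_of_star_eq_eG {x y : Ser × Ser} (hx : inG x)
    (h : _root_.star x y = eG) : starInv x = y := by
  rw [← star_eG (starInv x), ← h, ← star_assoc, (starInv_spec hx).2.2, eG_star]

theorem inG.bcomp {x : Ser × Ser} (hx : inG x) (c : Ser) : inG (bcomp x c) := by
  simpa [inG, _root_.bcomp, comp_eq_mcomp] using hx

theorem bcomp_odot (x y : Ser × Ser) (c : Ser) :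
    bcomp (odot x y) c = odot (bcomp x c) (bcomp y c) := by
  simp [bcomp, odot, comp_eq_mcomp, mcomp_add, mcomp_sh]

theorem tri_bcomp (x d : Ser × Ser) (c : Ser) :
    tri (bcomp x c) d = bcomp x (mcomp c d) := by
  simp [tri, bcomp, mcomp_comp]

theorem odotInv_eG : odotInv eG = eG := by
  have h : shInv one1 = one1 := shInv_eq_of_sh_eq_one1 (by simp [one1]) (sh_one1 _)
  simp [odotInv, eG, h]

theorem bcomp_eG (c : Ser) : bcomp eG c = eG := by
  simp [bcomp, eG, comp_eq_mcomp]

/-- the affine feedback product is a right action of the group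
`(G, ⊙)` on `ℝ⟨⟨X⟩⟩`: `(c @ x) @ y = c @ (x ⊙ y)` and `c @ e = c`. -/
theorem affine_feedback_right_action (c : Ser) (x y : Ser × Ser)
    (hx : inG x) (hy : inG y) :
    atp (atp c x) y = atp c (odot x y) ∧ atp c eG = c := by
  constructor
  · set P := bcomp (odotInv x) c with hP
    set Q := bcomp (odotInv y) (atp c x) with hQ
    have hPG : inG P := hx.odotInv.bcomp c
    have hQG : inG Q := hy.odotInv.bcomp _
    have hatp : atp c x = mcomp c (starInv P) := rfl
    have hQP : _root_.star Q P = bcomp (odotInv (odot x y)) c := by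
      rw [odotInv_odot hx hy, bcomp_odot, _root_.star, hQ, tri_bcomp, hatp, mcomp_mcomp,
        (starInv_spec hPG).2.2, mcomp_eG]
    change mcomp (mcomp c (starInv P)) (starInv Q) = _
    rw [mcomp_mcomp, atp, ← hQP]
    congr 1
    refine (starInv_eq_of_star_eq_eG (hQG.star hPG) ?_).symm
    rw [star_assoc, ← star_assoc P, (starInv_spec hPG).2.1, eG_star, (starInv_spec hQG).2.1]
  · rw [atp, odotInv_eG, bcomp_eG, starInv_eq_of_star_eq_eG inG_eG (eG_star eG), mcomp_eG]
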